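/- arXiv:math/9804120 — 2 statements merged into one kernel-verified Lean document; each statement's English description precedes it below -/
import Mathlib

section
/- Let L/F be a finite Galois extension with group G and S a finite G-set. Then the F-dimension of the space of G-invariants (L[S])^G, where G acts semilinearly on the free L-module L[S], equals the cardinality of S. -/
/-- The `F`-subspace of Galois-invariant elements of `L[S] = (S → L)` under the
semilinear action `g (∑ ℓ_s [s]) = ∑ g(ℓ_s) [g • s]`. -/
def galoisInvariants (F L : Type*) [Field F] [Field L] [Algebra F L]
    (S : Type*) [MulAction (L ≃ₐ[F] L) S] : Submodule F (S → L) where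
  carrier := {f | ∀ (g : L ≃ₐ[F] L) (s : S), g (f s) = f (g • s)}
  add_mem' := by
    intro f h hf hh g s
    simp only [Pi.add_apply, map_add, hf g s, hh g s]
  zero_mem' := by
    intro g s
    simp
  smul_mem' := by
    intro c f hf g s
    simp only [Pi.smul_apply, Algebra.smul_def, map_mul, AlgEquiv.commutes, hf g s]

theorem IsGalois.normalBasis_apply_mul {F L : Type*} [Field F] [Field L] [Algebra F L]
    [FiniteDimensional F L] [IsGalois F L] (h g : L ≃ₐ[F] L) :
    h (IsGalois.normalBasis F L g) = IsGalois.normalBasis F L (h * g) := by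
  rw [IsGalois.normalBasis_apply, IsGalois.normalBasis_apply (h * g), AlgEquiv.mul_apply]

/-- The Galois group translates coordinates with respect to the normal basis. -/
theorem IsGalois.normalBasis_repr_apply {F L : Type*} [Field F] [Field L] [Algebra F L]
    [FiniteDimensional F L] [IsGalois F L] (h g : L ≃ₐ[F] L) (x : L) :
    (IsGalois.normalBasis F L).repr (h x) g = (IsGalois.normalBasis F L).repr x (h⁻¹ * g) := by
  classical
  have key : (IsGalois.normalBasis F L).coord g ∘ₗ h.toLinearMap =
      (IsGalois.normalBasis F L).coord (h⁻¹ * g) := by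
    refine (IsGalois.normalBasis F L).ext fun k => ?_
    simp [IsGalois.normalBasis_apply_mul, Finsupp.single_apply, eq_inv_mul_iff_mul_eq]
  exact LinearMap.congr_fun key x

/-- An invariant element is determined by the coordinates of its values at the
generator of the normal basis, and these can be prescribed arbitrarily. -/
noncomputable def galoisInvariantsEquiv (F L : Type*) [Field F] [Field L] [Algebra F L]
    [FiniteDimensional F L] [IsGalois F L] (S : Type*) [MulAction (L ≃ₐ[F] L) S] :
    galoisInvariants F L S ≃ₗ[F] (S → F) where
  toFun f s := (IsGalois.normalBasis F L).repr (f.1 s) 1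
  map_add' f h := by ext s; simp
  map_smul' c f := by ext s; simp
  invFun a := ⟨fun s => (IsGalois.normalBasis F L).equivFun.symm fun g => a (g⁻¹ • s), by
    intro h s
    apply (IsGalois.normalBasis F L).equivFun.injective
    ext g
    rw [LinearEquiv.apply_symm_apply, Module.Basis.equivFun_apply,
      IsGalois.normalBasis_repr_apply, ← Module.Basis.equivFun_apply,
      LinearEquiv.apply_symm_apply, mul_inv_rev, inv_inv, mul_smul]⟩
  left_inv f := by
    ext s
    apply (IsGalois.normalBasis F L).equivFun.injective
    ext g
    simp only [LinearEquiv.apply_symm_apply, Module.Basis.equivFun_apply]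
    rw [← f.2 g⁻¹ s, IsGalois.normalBasis_repr_apply, inv_inv, mul_one]
  right_inv a := by
    ext s
    simp only [← Module.Basis.equivFun_apply, LinearEquiv.apply_symm_apply, inv_one, one_smul]

/-- For a finite Galois extension `L/F` with group `G` and a finite `G`-set `S`, the
`F`-dimension of the space of `G`-invariants of `L[S]` (with the semilinear action)
equals the cardinality of `S`. -/
theorem stmt2 (F L : Type*) [Field F] [Field L] [Algebra F L]
    [FiniteDimensional F L] [IsGalois F L]
    (S : Type*) [Fintype S] [MulAction (L ≃ₐ[F] L) S] :
    Module.finrank F (galoisInvariants F L S) = Fintype.card S := by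
  rw [(galoisInvariantsEquiv F L S).finrank_eq, Module.finrank_fintype_fun_eq_card]
end

section
/- Let F be a field and F(x) the rational function field in one variable. Then there is a split short exact sequence of Milnor K-groups: 0 → K^M_q(F) → K^M_q(F(x)) → ⊕_{π} K^M_{q-1}(F[x]/(π)) → 0, where π runs over the monic irreducible polynomials in F[x] and the maps to the summands are the tame symbols at the corresponding discrete valuations. -/
/-- The subgroup of relations defining Milnor K-theory: multilinearity and the
Steinberg relation. -/
def milnorRel (q : ℕ) (R : Type) [CommRing R] :
    AddSubgroup (FreeAbelianGroup (Fin q → Rˣ)) :=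
  AddSubgroup.closure
    ({x | ∃ (f : Fin q → Rˣ) (i : Fin q) (u v : Rˣ),
        x = FreeAbelianGroup.of (Function.update f i (u * v))
          - FreeAbelianGroup.of (Function.update f i u)
          - FreeAbelianGroup.of (Function.update f i v)} ∪
     {x | ∃ (f : Fin q → Rˣ) (i j : Fin q), i ≠ j ∧ (f i : R) + (f j : R) = 1 ∧
        x = FreeAbelianGroup.of f})

/-- The `q`-th Milnor K-group of a commutative ring `R`: the quotient of the free abelian
group on `q`-tuples of units by multilinearity and the Steinberg relations. -/
def MilnorK (q : ℕ) (R : Type) [CommRing R] : Type :=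
  FreeAbelianGroup (Fin q → Rˣ) ⧸ milnorRel q R

instance (q : ℕ) (R : Type) [CommRing R] : AddCommGroup (MilnorK q R) :=
  QuotientAddGroup.Quotient.addCommGroup _

/-- The Milnor symbol `{u₁, …, u_q}`. -/
def MilnorK.symbol (q : ℕ) (R : Type) [CommRing R] (f : Fin q → Rˣ) : MilnorK q R :=
  QuotientAddGroup.mk (FreeAbelianGroup.of f)

namespace MilnorK

open Function

section Basic

variable {q : ℕ} {R : Type} [CommRing R]

/-- The universal property of `MilnorK q R`. -/
def lift {A : Type*} [AddCommGroup A] (T : (Fin q → Rˣ) → A)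
    (hmul : ∀ f i u v, T (update f i (u * v)) = T (update f i u) + T (update f i v))
    (hst : ∀ (f : Fin q → Rˣ) i j, i ≠ j → (f i : R) + f j = 1 → T f = 0) :
    MilnorK q R →+ A :=
  QuotientAddGroup.lift _ (FreeAbelianGroup.lift T) (by
    refine (AddSubgroup.closure_le _).2 ?_
    rintro _ (⟨f, i, u, v, rfl⟩ | ⟨f, i, j, hij, h, rfl⟩)
    · simp [AddMonoidHom.mem_ker, hmul]
    · simpa [AddMonoidHom.mem_ker] using hst f i j hij h)

@[simp] lemma lift_symbol {A : Type*} [AddCommGroup A] (T : (Fin q → Rˣ) → A) (hmul) (hst)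
    (f : Fin q → Rˣ) : lift T hmul hst (symbol q R f) = T f := by
  unfold lift symbol
  exact FreeAbelianGroup.lift_apply_of T f

lemma closure_range_symbol :
    AddSubgroup.closure (Set.range (symbol q R)) = ⊤ := by
  refine eq_top_iff.2 fun x _ => ?_
  obtain ⟨x, rfl⟩ := QuotientAddGroup.mk_surjective x
  induction x using FreeAbelianGroup.induction_on with
  | zero => exact zero_mem _
  | of f => exact AddSubgroup.subset_closure (Set.mem_range_self f)
  | neg f _ =>
    exact (AddSubgroup.closure (Set.range (symbol q R))).neg_mem
      (AddSubgroup.subset_closure (Set.mem_range_self f))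
  | add x y hx hy => exact add_mem (hx trivial) (hy trivial)

lemma mem_of_symbol_mem {N : AddSubgroup (MilnorK q R)} (h : ∀ f, symbol q R f ∈ N)
    (x : MilnorK q R) : x ∈ N := by
  have : AddSubgroup.closure (Set.range (symbol q R)) ≤ N :=
    (AddSubgroup.closure_le _).2 (by rintro _ ⟨f, rfl⟩; exact h f)
  exact this (by rw [closure_range_symbol]; trivial)

lemma symbol_update_mul (f : Fin q → Rˣ) (i : Fin q) (u v : Rˣ) :
    symbol q R (update f i (u * v)) = symbol q R (update f i u) + symbol q R (update f i v) := by
  have : (QuotientAddGroup.mk (FreeAbelianGroup.of (update f i (u * v))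
      - FreeAbelianGroup.of (update f i u) - FreeAbelianGroup.of (update f i v)) :
      FreeAbelianGroup (Fin q → Rˣ) ⧸ milnorRel q R) = 0 :=
    (QuotientAddGroup.eq_zero_iff _).2
      (AddSubgroup.subset_closure (Or.inl ⟨f, i, u, v, rfl⟩))
  rw [QuotientAddGroup.mk_sub, QuotientAddGroup.mk_sub, sub_sub, sub_eq_zero] at this
  exact this

lemma symbol_eq_zero (f : Fin q → Rˣ) {i j : Fin q} (hij : i ≠ j) (h : (f i : R) + f j = 1) :
    symbol q R f = 0 :=
  (QuotientAddGroup.eq_zero_iff _).2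
    (AddSubgroup.subset_closure (Or.inr ⟨f, i, j, hij, h, rfl⟩))

/-- The symbol as a homomorphism in its `i`-th entry. -/
def slotHom (f : Fin q → Rˣ) (i : Fin q) : Additive Rˣ →+ MilnorK q R :=
  AddMonoidHom.mk' (fun u => symbol q R (update f i u.toMul))
    (fun _ _ => symbol_update_mul f i _ _)

/-- Left multiplication by `{u}`. -/
def consHom (u : Rˣ) : MilnorK q R →+ MilnorK (q + 1) R :=
  lift (fun f => symbol (q + 1) R (Fin.cons u f))
    (fun f i a b => by simp only [Fin.cons_update, symbol_update_mul])
    (fun f i j hij h => symbol_eq_zero _ (i := i.succ) (j := j.succ) (by simpa using hij)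
      (by simpa using h))

@[simp] lemma consHom_symbol (u : Rˣ) (f : Fin q → Rˣ) :
    consHom u (symbol q R f) = symbol (q + 1) R (Fin.cons u f) := lift_symbol _ _ _ _

/-- If symbols with entries in the sets `S i` lie in a subgroup, so do symbols with entries in the
subgroups that they generate. -/
lemma symbol_mem_of_mem_closure {N : AddSubgroup (MilnorK q R)} (S : Fin q → Set Rˣ)
    (h : ∀ f : Fin q → Rˣ, (∀ i, f i ∈ S i) → symbol q R f ∈ N) (f : Fin q → Rˣ)
    (hf : ∀ i, f i ∈ Subgroup.closure (S i)) : symbol q R f ∈ N := by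
  suffices ∀ (s : Finset (Fin q)) (f : Fin q → Rˣ), (∀ i ∈ s, f i ∈ Subgroup.closure (S i)) →
      (∀ i ∉ s, f i ∈ S i) → symbol q R f ∈ N from
    this Finset.univ f (fun i _ => hf i) (by simp)
  intro s
  induction s using Finset.induction_on with
  | empty => exact fun f _ hf => h f fun i => hf i (by simp)
  | insert i s hi ih =>
    intro f hf hf'
    have key : Subgroup.closure (S i) ≤ (N.comap (slotHom f i)).toSubgroup' := by
      refine (Subgroup.closure_le _).2 fun u hu => ?_
      change symbol q R (update f i u) ∈ N
      refine ih _ (fun j hj => ?_) fun j hj => ?_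
      · rw [update_of_ne (by rintro rfl; exact hi hj)]
        exact hf j (Finset.mem_insert_of_mem hj)
      · by_cases hji : j = i
        · subst hji; simpa using hu
        · rw [update_of_ne hji]
          exact hf' j (by simp [hji, hj])
    have := key (hf i (Finset.mem_insert_self _ _))
    change symbol q R (update f i (f i)) ∈ N at this
    simpa using this

end Basic

/-- The product of all Milnor K-groups. -/
abbrev Total (k : Type) [CommRing k] : Type := (n : ℕ) → MilnorK n k

/-- Multiplication by `{u}` on the product of all Milnor K-groups. -/
def lamEnd {k : Type} [CommRing k] (u : kˣ) : AddMonoid.End (Total k) :=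
  ({ toFun := fun x n => match n with
      | 0 => 0
      | n + 1 => consHom u (x n)
     map_zero' := by ext n; cases n <;> simp
     map_add' := fun x y => by ext n; cases n <;> simp } : Total k →+ Total k)

lemma consHom_mul {q : ℕ} {k : Type} [CommRing k] (u v : kˣ) (x : MilnorK q k) :
    consHom (u * v) x = consHom u x + consHom v x := by
  refine mem_of_symbol_mem
    (N := (consHom (u * v) : MilnorK q k →+ _).eqLocus (consHom u + consHom v)) (fun f => ?_) x
  change consHom _ _ = consHom _ _ + consHom _ _
  simpa using symbol_update_mul (Fin.cons 1 f) 0 u v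

/-- Multiplication by `{u}` on the product of all Milnor K-groups, as a homomorphism in `u`. -/
def lam (k : Type) [CommRing k] : Additive kˣ →+ AddMonoid.End (Total k) :=
  AddMonoidHom.mk' (fun u => lamEnd u.toMul) (fun u v => by
    ext x n
    cases n with
    | zero => exact (add_zero _).symm
    | succ n => exact consHom_mul _ _ _)

section lam

variable {k : Type} [CommRing k]

lemma lam_apply_succ (u : kˣ) (x : Total k) (n : ℕ) :
    lam k (.ofMul u) x (n + 1) = consHom u (x n) := rfl

lemma lam_apply_zero (u : kˣ) (x : Total k) : lam k (.ofMul u) x 0 = 0 := rfl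

lemma lam_single (u : kˣ) (n : ℕ) (x : MilnorK n k) :
    lam k (.ofMul u) (Pi.single n x) = Pi.single (n + 1) (consHom u x) := by
  ext m
  cases m with
  | zero => rw [Pi.single_eq_of_ne (by simp)]; rfl
  | succ m =>
    rw [lam_apply_succ]
    by_cases h : m = n
    · subst h; simp
    · rw [Pi.single_eq_of_ne h, Pi.single_eq_of_ne (by simpa using h), map_zero]

lemma lam_steinberg {u v : kˣ} (h : (u : k) + v = 1) :
    lam k (.ofMul u) * lam k (.ofMul v) = 0 := by
  ext x n
  change lam k (.ofMul u) (lam k (.ofMul v) x) n = 0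
  rcases n with _ | _ | n
  · rfl
  · rw [lam_apply_succ, lam_apply_zero, map_zero]
  · rw [lam_apply_succ, lam_apply_succ]
    refine mem_of_symbol_mem (N := ((consHom u).comp (consHom v)).ker) (fun f => ?_) (x n)
    rw [AddMonoidHom.mem_ker, AddMonoidHom.comp_apply, consHom_symbol, consHom_symbol]
    exact symbol_eq_zero _ (i := 0) (j := 1) (by simp) (by simpa using h)

end lam

section Ring

variable {K : Type} [CommRing K] {E : Type*} [Ring E] {Λ : Additive Kˣ →+ E}

/-- A homomorphism from the unit group to a ring that satisfies the Steinberg relation. -/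
def IsSteinberg (Λ : Additive Kˣ →+ E) : Prop :=
  ∀ u v : Kˣ, (u : K) + v = 1 → Λ (.ofMul u) * Λ (.ofMul v) = 0

namespace IsSteinberg

lemma mul_neg_self (hK : IsField K) (h : IsSteinberg Λ) (u : Kˣ) :
    Λ (.ofMul u) * Λ (.ofMul (-u)) = 0 := by
  let := hK.toField
  by_cases hu : u = 1
  · simp [hu]
  have h1 : (1 : K) - u ≠ 0 := fun h => hu (Units.ext (sub_eq_zero.1 h).symm)
  have h2 : (1 : K) - ↑u⁻¹ ≠ 0 := fun h => hu (inv_eq_one.1 (Units.ext (sub_eq_zero.1 h).symm))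
  obtain ⟨a, ha⟩ := (isUnit_iff_ne_zero (a := (1 : K) - u)).2 h1
  obtain ⟨b, hb⟩ := (isUnit_iff_ne_zero (a := (1 : K) - ↑u⁻¹)).2 h2
  have hab : -u = a * b⁻¹ := by
    rw [eq_mul_inv_iff_mul_eq]
    ext
    simp [ha, hb, mul_sub]
  have e1 := h u a (by simp [ha])
  have e2 := h u⁻¹ b (by simp [hb])
  rw [ofMul_inv, map_neg, neg_mul, neg_eq_zero] at e2
  rw [hab, ofMul_mul, ofMul_inv, map_add, map_neg, mul_add, mul_neg, e1, e2, neg_zero, add_zero]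

lemma mul_self (hK : IsField K) (h : IsSteinberg Λ) (u : Kˣ) :
    Λ (.ofMul u) * Λ (.ofMul u) = Λ (.ofMul u) * Λ (.ofMul (-1)) := by
  have := h.mul_neg_self hK u
  rw [← neg_one_mul, ofMul_mul, map_add, mul_add] at this
  have h2 : Λ (.ofMul (-1)) + Λ (.ofMul (-1)) = 0 := by
    rw [← map_add, ← ofMul_mul]; simp
  have h3 : Λ (.ofMul u) * Λ (.ofMul (-1)) + Λ (.ofMul u) * Λ (.ofMul (-1)) = 0 := by
    rw [← mul_add, h2, mul_zero]
  rw [← sub_eq_zero, sub_eq_add_neg, ← eq_neg_of_add_eq_zero_left h3, add_comm, this]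

lemma anticomm (hK : IsField K) (h : IsSteinberg Λ) (u v : Kˣ) :
    Λ (.ofMul u) * Λ (.ofMul v) = -(Λ (.ofMul v) * Λ (.ofMul u)) := by
  have e := h.mul_neg_self hK (u * v)
  have e1 := h.mul_neg_self hK u
  have e2 := h.mul_neg_self hK v
  have a1 : -(u * v) = -u * v := by simp
  have a2 : -(u * v) = -v * u := by simp [mul_comm]
  rw [ofMul_mul, map_add, add_mul] at e
  nth_rewrite 1 [a1] at e
  rw [a2] at e
  simp only [ofMul_mul, map_add, mul_add, e1, e2, zero_add] at e
  exact eq_neg_of_add_eq_zero_left e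

end IsSteinberg

/-- The ordered product of the values of `Λ` on a tuple. -/
def prodOf (Λ : Additive Kˣ →+ E) {n : ℕ} (f : Fin n → Kˣ) : E :=
  (List.ofFn fun i => Λ (.ofMul (f i))).prod

lemma prodOf_zero (f : Fin 0 → Kˣ) : prodOf Λ f = 1 := by simp [prodOf]

lemma prodOf_cons {n : ℕ} (u : Kˣ) (f : Fin n → Kˣ) :
    prodOf Λ (Fin.cons u f : Fin (n + 1) → Kˣ) = Λ (.ofMul u) * prodOf Λ f := by
  simp [prodOf]

lemma prodOf_update_mul {n : ℕ} (f : Fin n → Kˣ) (i : Fin n) (u v : Kˣ) :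
    prodOf Λ (update f i (u * v)) = prodOf Λ (update f i u) + prodOf Λ (update f i v) := by
  induction n with
  | zero => exact i.elim0
  | succ n ih =>
    induction f using Fin.consCases with
    | cons a f =>
      cases i using Fin.cases with
      | zero => simp only [Fin.update_cons_zero, prodOf_cons, ofMul_mul, map_add, add_mul]
      | succ i => simp only [← Fin.cons_update, prodOf_cons, ih, mul_add]

lemma IsSteinberg.mul_prodOf (hK : IsField K) (h : IsSteinberg Λ) {n : ℕ} (a : Kˣ)
    (f : Fin n → Kˣ) (i : Fin n) (hi : (a : K) + f i = 1) : Λ (.ofMul a) * prodOf Λ f = 0 := by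
  induction n with
  | zero => exact i.elim0
  | succ n ih =>
    induction f using Fin.consCases with
    | cons b f =>
      rw [prodOf_cons, ← mul_assoc]
      cases i using Fin.cases with
      | zero => rw [h a b (by simpa using hi), zero_mul]
      | succ i =>
        rw [h.anticomm hK, neg_mul, mul_assoc, ih f i (by simpa using hi), mul_zero, neg_zero]

lemma IsSteinberg.prodOf_eq_zero (hK : IsField K) (h : IsSteinberg Λ) {n : ℕ}
    (f : Fin n → Kˣ) (i j : Fin n) (hij : i ≠ j) (hi : (f i : K) + f j = 1) :
    prodOf Λ f = 0 := by
  induction n with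
  | zero => exact i.elim0
  | succ n ih =>
    induction f using Fin.consCases with
    | cons b f =>
      rw [prodOf_cons]
      cases i using Fin.cases with
      | zero =>
        cases j using Fin.cases with
        | zero => exact absurd rfl hij
        | succ j => exact h.mul_prodOf hK b f j (by simpa using hi)
      | succ i =>
        cases j using Fin.cases with
        | zero => exact h.mul_prodOf hK b f i (by simpa [add_comm] using hi)
        | succ j =>
          rw [ih f i j (by simpa using hij) (by simpa using hi), mul_zero]

/-- The homomorphism to `E` that sends a symbol to the product of the values of `Λ`. -/
def liftRing (hK : IsField K) (h : IsSteinberg Λ) (n : ℕ) : MilnorK n K →+ E :=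
  lift (prodOf Λ) prodOf_update_mul (h.prodOf_eq_zero hK)

lemma liftRing_symbol (hK : IsField K) (h : IsSteinberg Λ) (n : ℕ) (f : Fin n → Kˣ) :
    liftRing hK h n (symbol n K f) = prodOf Λ f := lift_symbol _ _ _ _

end Ring

section Tame

variable (K k : Type) [CommRing K] [CommRing k]

/-- A valuation together with an angular component. -/
structure TamePair where
  /-- the valuation -/
  v : Kˣ →* Multiplicative ℤ
  /-- the angular component -/
  ρ : Kˣ →* kˣ
  /-- The Steinberg relation only involves pairs of one of these shapes. -/
  steinberg : ∀ f g : Kˣ, (f : K) + g = 1 →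
    (v f = 1 ∧ ρ f = 1) ∨ (v g = 1 ∧ ρ g = 1) ∨
      (v f = 1 ∧ v g = 1 ∧ (ρ f : k) + ρ g = 1) ∨ (v f = v g ∧ ρ f = -ρ g)

variable {K k}

namespace TamePair

variable (P : TamePair K k)

/-- The operator of multiplication by `v f • ξ + {ρ f}`, in terms of coefficients of `1`
and `ξ`, where `ξ` is a symbol of degree one with `ξ² = {-1} ξ`. -/
def opEnd (f : Kˣ) : AddMonoid.End (Total k × Total k) :=
  (((lam k (.ofMul (P.ρ f))).comp (AddMonoidHom.fst _ _)).prod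
    ((P.v f).toAdd • AddMonoidHom.fst (Total k) (Total k) +
      ((P.v f).toAdd • lam k (.ofMul (-1)) - lam k (.ofMul (P.ρ f)) : AddMonoid.End _).comp
        (AddMonoidHom.snd (Total k) (Total k))) : Total k × Total k →+ Total k × Total k)

lemma opEnd_apply (f : Kˣ) (x : Total k × Total k) :
    P.opEnd f x = (lam k (.ofMul (P.ρ f)) x.1,
      (P.v f).toAdd • x.1 + ((P.v f).toAdd • lam k (.ofMul (-1)) x.2 -
        lam k (.ofMul (P.ρ f)) x.2)) := rfl

/-- `opEnd` as a homomorphism. -/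
def op : Additive Kˣ →+ AddMonoid.End (Total k × Total k) :=
  AddMonoidHom.mk' (fun f => P.opEnd f.toMul) (fun f g => by
    refine AddMonoidHom.ext fun x => ?_
    change P.opEnd _ x = P.opEnd _ x + P.opEnd _ x
    rw [opEnd_apply, opEnd_apply, opEnd_apply]
    have e (y : Total k) : lam k (.ofMul (P.ρ (f + g).toMul)) y =
        lam k (.ofMul (P.ρ f.toMul)) y + lam k (.ofMul (P.ρ g.toMul)) y := by
      rw [toMul_add, map_mul, ofMul_mul, map_add]; rfl
    simp only [e]
    simp only [toMul_add, map_mul, toAdd_mul, add_smul]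
    refine Prod.ext rfl ?_
    simp only [Prod.mk_add_mk]
    abel)

lemma op_apply (f : Kˣ) (x : Total k × Total k) :
    P.op (.ofMul f) x = (lam k (.ofMul (P.ρ f)) x.1,
      (P.v f).toAdd • x.1 + ((P.v f).toAdd • lam k (.ofMul (-1)) x.2 -
        lam k (.ofMul (P.ρ f)) x.2)) := rfl

lemma isSteinberg_op (hk : IsField k) : IsSteinberg P.op := by
  intro f g hfg
  have hlam : IsSteinberg (lam k) := fun u v h => lam_steinberg h
  refine AddMonoidHom.ext fun x => ?_
  obtain ⟨s, D⟩ := x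
  change P.op (.ofMul f) (P.op (.ofMul g) (s, D)) = 0
  rw [op_apply, op_apply]
  rcases P.steinberg f g hfg with ⟨h1, h2⟩ | ⟨h1, h2⟩ | ⟨h1, h2, h3⟩ | ⟨h1, h2⟩
  · simp [h1, h2]
  · simp [h1, h2]
  · have e (y : Total k) : lam k (.ofMul (P.ρ f)) (lam k (.ofMul (P.ρ g)) y) = 0 :=
      DFunLike.congr_fun (hlam _ _ h3) y
    simp [h1, h2, e]
  · have hm (y : Total k) : lam k (.ofMul (-1)) y + lam k (.ofMul (-1)) y = 0 := by
      have : lam k (.ofMul (-1)) + lam k (.ofMul (-1)) = 0 := by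
        rw [← map_add, ← ofMul_mul]; simp
      exact DFunLike.congr_fun this y
    have hf (y : Total k) : lam k (.ofMul (P.ρ f)) y =
        lam k (.ofMul (-1)) y + lam k (.ofMul (P.ρ g)) y := by
      rw [h2, ← neg_one_mul, ofMul_mul, map_add]; rfl
    have hbb (y : Total k) : lam k (.ofMul (P.ρ g)) (lam k (.ofMul (P.ρ g)) y) =
        lam k (.ofMul (P.ρ g)) (lam k (.ofMul (-1)) y) :=
      DFunLike.congr_fun (hlam.mul_self hk _) y
    have hmb (y : Total k) : lam k (.ofMul (-1)) (lam k (.ofMul (P.ρ g)) y) =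
        -lam k (.ofMul (P.ρ g)) (lam k (.ofMul (-1)) y) :=
      DFunLike.congr_fun (hlam.anticomm hk _ _) y
    obtain ⟨c, hc⟩ := Int.even_mul_pred_self (P.v g).toAdd
    have hc' (y : Total k) : ((P.v g).toAdd * (P.v g).toAdd) • lam k (.ofMul (-1)) y =
        (P.v g).toAdd • lam k (.ofMul (-1)) y := by
      rw [show (P.v g).toAdd * (P.v g).toAdd = (c + c) + (P.v g).toAdd by rw [← hc]; ring,
        add_smul, add_smul, ← smul_add, hm, smul_zero, zero_add]
    refine Prod.ext ?_ ?_
    · simp [hf, hbb, hmb]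
    · simp only [h1, hf, map_add, map_sub, map_zsmul, smul_add, smul_sub, smul_smul, hbb, hmb, hc',
        Prod.snd_zero]
      simp only [smul_neg]
      abel

variable (hK : IsField K) (hk : IsField k)

/-- The pair of specialization and tame symbol, inside the products of all Milnor K-groups. -/
def total (n : ℕ) : MilnorK n K →+ Total k × Total k :=
  AddMonoidHom.mk' (fun x => liftRing hK (P.isSteinberg_op hk) n x
    ((Pi.single 0 (symbol 0 k Fin.elim0) : Total k), (0 : Total k))) (fun x y => by
      rw [map_add]; rfl)

lemma total_symbol (n : ℕ) (f : Fin n → Kˣ) : P.total hK hk n (symbol n K f) =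
    prodOf P.op f ((Pi.single 0 (symbol 0 k Fin.elim0) : Total k), (0 : Total k)) := by
  change liftRing hK (P.isSteinberg_op hk) n (symbol n K f) _ = _
  rw [liftRing_symbol]

lemma total_symbol_cons (n : ℕ) (a : Kˣ) (f : Fin n → Kˣ) :
    P.total hK hk (n + 1) (symbol (n + 1) K (Fin.cons a f)) =
      P.op (.ofMul a) (P.total hK hk n (symbol n K f)) := by
  rw [total_symbol, total_symbol, prodOf_cons]; rfl

lemma total_symbol_fst (n : ℕ) (f : Fin n → Kˣ) :
    (P.total hK hk n (symbol n K f)).1 = Pi.single n (symbol n k fun i => P.ρ (f i)) := by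
  induction n with
  | zero =>
    rw [total_symbol, prodOf_zero, AddMonoid.End.coe_one, id_eq,
      Subsingleton.elim (fun i => P.ρ (f i)) Fin.elim0]
  | succ n ih =>
    induction f using Fin.consCases with
    | cons a f =>
      rw [total_symbol_cons, op_apply]
      simp only [ih, lam_single, consHom_symbol]
      congr 2
      ext i
      cases i using Fin.cases <;> simp

lemma total_symbol_snd (n : ℕ) (f : Fin n → Kˣ) (hf : ∀ i, P.v (f i) = 1) :
    (P.total hK hk n (symbol n K f)).2 = 0 := by
  induction n with
  | zero => rw [total_symbol, prodOf_zero, AddMonoid.End.coe_one, id_eq]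
  | succ n ih =>
    induction f using Fin.consCases with
    | cons a f =>
      have ha : P.v a = 1 := by simpa using hf 0
      rw [total_symbol_cons, op_apply]
      simp [ih f (fun i => by simpa using hf i.succ), ha]

/-- The specialization map. -/
def spec (n : ℕ) : MilnorK n K →+ MilnorK n k :=
  (Pi.evalAddMonoidHom (fun n => MilnorK n k) n).comp
    ((AddMonoidHom.fst (Total k) (Total k)).comp (P.total hK hk n))

/-- The tame symbol. -/
def tame (n : ℕ) : MilnorK (n + 1) K →+ MilnorK n k :=
  (Pi.evalAddMonoidHom (fun n => MilnorK n k) n).comp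
    ((AddMonoidHom.snd (Total k) (Total k)).comp (P.total hK hk (n + 1)))

lemma spec_symbol (n : ℕ) (f : Fin n → Kˣ) :
    P.spec hK hk n (symbol n K f) = symbol n k fun i => P.ρ (f i) := by
  change (P.total hK hk n (symbol n K f)).1 n = _
  rw [total_symbol_fst, Pi.single_eq_same]

lemma tame_symbol_eq_zero (n : ℕ) (f : Fin (n + 1) → Kˣ) (hf : ∀ i, P.v (f i) = 1) :
    P.tame hK hk n (symbol (n + 1) K f) = 0 := by
  change (P.total hK hk (n + 1) (symbol (n + 1) K f)).2 n = _
  rw [total_symbol_snd _ _ _ _ _ hf]; rfl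

lemma tame_symbol_cons (n : ℕ) (a : Kˣ) (f : Fin n → Kˣ) (ha : P.v a = .ofAdd 1)
    (hf : ∀ i, P.v (f i) = 1) :
    P.tame hK hk n (symbol (n + 1) K (Fin.cons a f)) = symbol n k fun i => P.ρ (f i) := by
  change (P.total hK hk (n + 1) (symbol (n + 1) K (Fin.cons a f))).2 n = _
  rw [total_symbol_cons, op_apply, total_symbol_fst, total_symbol_snd _ _ _ _ _ hf]
  simp [ha]

end TamePair

end Tame

section Swap

variable {K : Type} [CommRing K] {n : ℕ}

lemma lam_isSteinberg : IsSteinberg (lam K) := fun _ _ h => lam_steinberg h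

/-- A relation between products of two symbols of degree one. -/
lemma consHom_consHom (u v : Kˣ) (x : MilnorK n K) : consHom u (consHom v x) =
    (lam K (.ofMul u) * lam K (.ofMul v)) (Pi.single n x) (n + 2) := by
  change _ = lam K (.ofMul u) (lam K (.ofMul v) (Pi.single n x)) (n + 2)
  rw [lam_single, lam_single, Pi.single_eq_same]

lemma consHom_swap (hK : IsField K) (u v : Kˣ) (x : MilnorK n K) :
    consHom u (consHom v x) = -consHom v (consHom u x) := by
  rw [consHom_consHom, consHom_consHom, lam_isSteinberg.anticomm hK]; rfl

lemma consHom_self (hK : IsField K) (u : Kˣ) (x : MilnorK n K) :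
    consHom u (consHom u x) = consHom u (consHom (-1) x) := by
  rw [consHom_consHom, consHom_consHom, lam_isSteinberg.mul_self hK]

lemma consHom_steinberg {u v : Kˣ} (h : (u : K) + v = 1) (x : MilnorK n K) :
    consHom u (consHom v x) = 0 := by
  rw [consHom_consHom, lam_steinberg h]; rfl

end Swap

open Polynomial
open scoped nonZeroDivisors

section RatFunc

variable {F : Type} [Field F]

/-- A nonzero polynomial as a unit of the rational function field. -/
noncomputable def pu (p : F[X]) (hp : p ≠ 0) : (RatFunc F)ˣ :=
  Units.mk0 (algebraMap F[X] (RatFunc F) p) (by simpa using hp)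

@[simp] lemma coe_pu (p : F[X]) (hp : p ≠ 0) :
    (pu p hp : RatFunc F) = algebraMap F[X] (RatFunc F) p := rfl

lemma pu_mul {p q : F[X]} (hp : p ≠ 0) (hq : q ≠ 0) :
    pu (p * q) (mul_ne_zero hp hq) = pu p hp * pu q hq := by
  ext; simp

lemma exists_eq_div (f : (RatFunc F)ˣ) :
    ∃ (a b : F[X]) (ha : a ≠ 0) (hb : b ≠ 0), f = pu a ha / pu b hb := by
  refine ⟨(f : RatFunc F).num, (f : RatFunc F).denom, RatFunc.num_ne_zero f.ne_zero,
    RatFunc.denom_ne_zero _, ?_⟩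
  ext
  simp [RatFunc.num_div_denom]

lemma exists_extend {G : Type*} [CommGroup G] (φ : F[X] → G)
    (hφ : ∀ p q, p ≠ 0 → q ≠ 0 → φ (p * q) = φ p * φ q) :
    ∃ ψ : (RatFunc F)ˣ →* G, ∀ p hp, ψ (pu p hp) = φ p := by
  classical
  have h1 : φ 1 = 1 := by simpa using hφ 1 1 one_ne_zero one_ne_zero
  let Φ : F[X] →*₀ WithZero G :=
    { toFun p := if p = 0 then 0 else (φ p : WithZero G)
      map_zero' := by simp
      map_one' := by simp [h1]
      map_mul' p q := by
        by_cases hp : p = 0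
        · simp [hp]
        by_cases hq : q = 0
        · simp [hq]
        simp [hp, hq, hφ] }
  have hΦ : F[X]⁰ ≤ (WithZero G)⁰.comap Φ := by
    intro p hp
    have hp : p ≠ 0 := nonZeroDivisors.ne_zero hp
    simp [Φ, hp]
  refine ⟨(WithZero.unitsWithZeroEquiv (α := G)).toMonoidHom.comp
    (Units.map (RatFunc.liftMonoidWithZeroHom Φ hΦ : RatFunc F →* WithZero G)), fun p hp => ?_⟩
  rw [← WithZero.coe_inj]
  have : RatFunc.liftMonoidWithZeroHom Φ hΦ (algebraMap F[X] (RatFunc F) p) = φ p := by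
    simpa [Φ, hp, h1] using RatFunc.liftMonoidWithZeroHom_apply_div Φ hΦ p 1
  simpa using this

variable {k : Type} [CommRing k]

lemma exists_tamePair (φ : F[X] → Multiplicative ℤ × kˣ)
    (hφ : ∀ p q, p ≠ 0 → q ≠ 0 → φ (p * q) = φ p * φ q)
    (hadd : ∀ a b, a ≠ 0 → b ≠ 0 → a + b ≠ 0 →
      φ a = φ (a + b) ∨ φ b = φ (a + b) ∨
      ((φ a).1 = (φ (a + b)).1 ∧ (φ b).1 = (φ (a + b)).1 ∧
        ((φ a).2 : k) + (φ b).2 = (φ (a + b)).2) ∨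
      ((φ a).1 = (φ b).1 ∧ (φ a).2 = -(φ b).2)) :
    ∃ P : TamePair (RatFunc F) k, ∀ p hp, P.v (pu p hp) = (φ p).1 ∧ P.ρ (pu p hp) = (φ p).2 := by
  obtain ⟨ψ, hψ⟩ := exists_extend φ hφ
  refine ⟨⟨(MonoidHom.fst _ _).comp ψ, (MonoidHom.snd _ _).comp ψ, fun f g hfg => ?_⟩,
    fun p hp => by simp [hψ]⟩
  obtain ⟨a, c, ha, hc, rfl⟩ := exists_eq_div f
  have hc' : algebraMap F[X] (RatFunc F) c ≠ 0 := by simpa using hc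
  have hg : (g : RatFunc F) * algebraMap F[X] (RatFunc F) c =
      algebraMap F[X] (RatFunc F) (c - a) := by
    rw [← eq_sub_iff_add_eq'] at hfg
    rw [hfg]
    simp [sub_mul, hc']
  have hb : c - a ≠ 0 := by
    intro h
    rw [h, map_zero] at hg
    exact mul_ne_zero g.ne_zero hc' hg
  obtain ⟨b, rfl⟩ : ∃ b, c = a + b := ⟨c - a, by ring⟩
  have hab : a + b - a = b := by ring
  rw [hab] at hg hb
  have hg' : g = pu b hb / pu (a + b) hc := by
    rw [eq_div_iff_mul_eq']
    ext; simpa [mul_comm] using hg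
  subst hg'
  simp only [MonoidHom.comp_apply, _root_.map_div, hψ, MonoidHom.coe_fst, MonoidHom.coe_snd]
  rcases hadd a b ha hb hc with h | h | ⟨h1, h2, h3⟩ | ⟨h1, h2⟩
  · simp [h]
  · simp [h]
  · refine Or.inr (Or.inr (Or.inl ⟨by simp [h1], by simp [h2], ?_⟩))
    simp only [div_eq_mul_inv, Units.val_mul, ← add_mul, h3, Units.mul_inv]
  · refine Or.inr (Or.inr (Or.inr ⟨by simp [h1], ?_⟩))
    ext
    simp [h2, div_eq_mul_inv]

lemma exists_tamePair_leadingCoeff : ∃ P : TamePair (RatFunc F) F,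
    ∀ p hp, (P.ρ (pu p hp) : F) = p.leadingCoeff := by
  classical
  let φ (p : F[X]) : Multiplicative ℤ × Fˣ := (.ofAdd p.natDegree,
    if hp : p = 0 then 1 else Units.mk0 p.leadingCoeff (leadingCoeff_ne_zero.2 hp))
  have h2 (p : F[X]) (hp : p ≠ 0) : ((φ p).2 : F) = p.leadingCoeff := by simp [φ, hp]
  have ext' (p q : F[X]) (hp : p ≠ 0) (hq : q ≠ 0) (h : p.natDegree = q.natDegree)
      (h' : p.leadingCoeff = q.leadingCoeff) : φ p = φ q := by
    refine Prod.ext (by simp [φ, h]) ?_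
    ext
    rw [h2 p hp, h2 q hq, h']
  obtain ⟨P, hP⟩ := exists_tamePair φ (fun p q hp hq => by
      refine Prod.ext (by simp [φ, natDegree_mul hp hq]) (Units.ext ?_)
      rw [Prod.snd_mul, Units.val_mul, h2 _ hp, h2 _ hq, h2 _ (mul_ne_zero hp hq),
        leadingCoeff_mul]) (fun a b ha hb hab => by
      rcases lt_trichotomy a.natDegree b.natDegree with h | h | h
      · refine Or.inr (Or.inl (ext' _ _ hb hab (natDegree_add_eq_right_of_natDegree_lt h).symm
          (leadingCoeff_add_of_degree_lt (degree_lt_degree h)).symm))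
      · by_cases h0 : a.leadingCoeff + b.leadingCoeff = 0
        · refine Or.inr (Or.inr (Or.inr ⟨by simp [φ, h], ?_⟩))
          ext
          rw [Units.val_neg, h2 _ ha, h2 _ hb, eq_neg_of_add_eq_zero_left h0]
        · have hd : a.degree = b.degree := by
            rw [degree_eq_natDegree ha, degree_eq_natDegree hb, h]
          have hl := leadingCoeff_add_of_degree_eq hd h0
          have hn : (a + b).natDegree = b.natDegree := by
            refine le_antisymm ((natDegree_add_le _ _).trans (by simp [h])) ?_
            refine le_natDegree_of_ne_zero ?_
            rw [coeff_add]
            nth_rewrite 1 [← h]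
            exact h0
          refine Or.inr (Or.inr (Or.inl ⟨by simp [φ, h, hn], by simp [φ, hn], ?_⟩))
          rw [h2 _ ha, h2 _ hb, h2 _ hab, hl]
      · refine Or.inl (ext' _ _ ha hab (natDegree_add_eq_left_of_natDegree_lt h).symm
          (leadingCoeff_add_of_degree_lt' (degree_lt_degree h)).symm))
  exact ⟨P, fun p hp => by rw [(hP p hp).2, h2 p hp]⟩

lemma pow_mul_unique {π a b : F[X]} (hπ : π ≠ 0) {m n : ℕ} (ha : ¬π ∣ a) (hb : ¬π ∣ b)
    (h : π ^ m * a = π ^ n * b) : m = n ∧ a = b := by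
  have aux {m n : ℕ} {a b : F[X]} (ha : ¬π ∣ a) (h : π ^ m * a = π ^ n * b) : n ≤ m := by
    by_contra! hlt
    obtain ⟨c, rfl⟩ := Nat.exists_eq_add_of_lt hlt
    rw [pow_succ, pow_add, mul_assoc, mul_assoc] at h
    exact ha ⟨π ^ c * b, by
      rw [mul_left_cancel₀ (pow_ne_zero _ hπ) h]; ring⟩
  obtain rfl := le_antisymm (aux hb h.symm) (aux ha h)
  exact ⟨rfl, mul_left_cancel₀ (pow_ne_zero _ hπ) h⟩

lemma isField_quotient {π : F[X]} (hπ : Irreducible π) : IsField (F[X] ⧸ Ideal.span {π}) :=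
  have := PrincipalIdealRing.isMaximal_of_irreducible hπ
  (Ideal.Quotient.maximal_ideal_iff_isField_quotient _).1 this

lemma isUnit_mk {π : F[X]} (hπ : Irreducible π) {p : F[X]} (hp : ¬π ∣ p) :
    IsUnit (Ideal.Quotient.mk (Ideal.span {π}) p) := by
  let := (isField_quotient hπ).toField
  refine (isUnit_iff_ne_zero (a := Ideal.Quotient.mk (Ideal.span {π}) p)).2 ?_
  rwa [Ne, Ideal.Quotient.eq_zero_iff_dvd]

lemma exists_tamePair_irreducible {π : F[X]} (hπ : Irreducible π) :
    ∃ P : TamePair (RatFunc F) (F[X] ⧸ Ideal.span {π}),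
      (P.v (pu π hπ.ne_zero) = .ofAdd 1) ∧
      ∀ p hp, ¬π ∣ p → P.v (pu p hp) = 1 ∧
        (P.ρ (pu p hp) : F[X] ⧸ Ideal.span {π}) = Ideal.Quotient.mk _ p := by
  classical
  have hex (p : F[X]) (hp : p ≠ 0) : ∃ (n : ℕ) (c : F[X]), ¬π ∣ c ∧ p = π ^ n * c :=
    WfDvdMonoid.max_power_factor hp hπ
  choose! n c hc hpc using hex
  let φ (p : F[X]) : Multiplicative ℤ × (F[X] ⧸ Ideal.span {π})ˣ := (.ofAdd (n p),
    if hp : p = 0 then 1 else (isUnit_mk hπ (hc p hp)).unit)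
  have huniq (p : F[X]) (m : ℕ) (a : F[X]) (hp : p ≠ 0) (ha : ¬π ∣ a) (h : p = π ^ m * a) :
      n p = m ∧ c p = a :=
    pow_mul_unique hπ.ne_zero (hc p hp) ha ((hpc p hp).symm.trans h)
  have h2 (p : F[X]) (hp : p ≠ 0) :
      ((φ p).2 : F[X] ⧸ Ideal.span {π}) = Ideal.Quotient.mk _ (c p) := by simp [φ, hp]
  have ext' (p q : F[X]) (hp : p ≠ 0) (hq : q ≠ 0) (h : n p = n q)
      (h' : π ∣ c p - c q) : φ p = φ q := by
    refine Prod.ext (by simp [φ, h]) ?_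
    ext
    rw [h2 p hp, h2 q hq, Ideal.Quotient.eq, Ideal.mem_span_singleton]
    exact h'
  have hlt {a b : F[X]} (ha : a ≠ 0) (hb : b ≠ 0) (hab : a + b ≠ 0) (h : n a < n b) :
      φ a = φ (a + b) := by
    obtain ⟨e, he⟩ := Nat.exists_eq_add_of_lt h
    have hd : ¬π ∣ c a + π ^ (e + 1) * c b := by
      rw [pow_succ', mul_assoc, dvd_add_left (dvd_mul_right _ _)]
      exact hc a ha
    obtain ⟨h1, h3⟩ := huniq (a + b) (n a) _ hab hd (by
      nth_rewrite 1 [hpc a ha, hpc b hb, he]; ring)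
    refine ext' _ _ ha hab h1.symm ?_
    rw [h3, pow_succ']
    exact ⟨-(π ^ e * c b), by ring⟩
  obtain ⟨P, hP⟩ := exists_tamePair φ (fun p q hp hq => by
      obtain ⟨h1, h3⟩ := huniq (p * q) (n p + n q) (c p * c q) (mul_ne_zero hp hq)
        (fun h => (hπ.prime.dvd_or_dvd h).elim (hc p hp) (hc q hq)) (by
          nth_rewrite 1 [hpc p hp, hpc q hq]; ring)
      refine Prod.ext (by simp [φ, h1]) (Units.ext ?_)
      rw [Prod.snd_mul, Units.val_mul, h2 _ hp, h2 _ hq, h2 _ (mul_ne_zero hp hq),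
        h3, map_mul]) (fun a b ha hb hab => by
      rcases lt_trichotomy (n a) (n b) with h | h | h
      · exact Or.inl (hlt ha hb hab h)
      · have hsum : a + b = π ^ n b * (c a + c b) := by
          nth_rewrite 1 [hpc a ha, hpc b hb, h]; ring
        by_cases h0 : π ∣ c a + c b
        · refine Or.inr (Or.inr (Or.inr ⟨by simp [φ, h], ?_⟩))
          ext
          rw [Units.val_neg, h2 _ ha, h2 _ hb, ← map_neg, Ideal.Quotient.eq,
            Ideal.mem_span_singleton, sub_neg_eq_add]
          exact h0
        · obtain ⟨h1, h3⟩ := huniq _ _ _ hab h0 hsum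
          refine Or.inr (Or.inr (Or.inl ⟨by simp [φ, h, h1], by simp [φ, h1], ?_⟩))
          rw [h2 _ ha, h2 _ hb, h2 _ hab, h3, map_add]
      · rw [add_comm a b] at hab ⊢
        exact Or.inr (Or.inl (hlt hb ha hab h)))
  refine ⟨P, ?_, fun p hp hpπ => ?_⟩
  · rw [(hP _ _).1]
    obtain ⟨h1, -⟩ := huniq π 1 1 hπ.ne_zero (fun h => hπ.not_isUnit (isUnit_of_dvd_one h))
      (by ring)
    simp [φ, h1]
  · obtain ⟨h1, h3⟩ := huniq p 0 p hp hpπ (by ring)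
    rw [(hP _ _).1, (hP _ _).2, h2 p hp, h3]
    simp [φ, h1]

end RatFunc

section Filtration

variable {F : Type} [Field F]

variable (F) in
/-- The monic irreducible polynomials over `F`. -/
abbrev MonicIrred : Type := {π : F[X] // π.Monic ∧ Irreducible π}

namespace MonicIrred

variable (π : MonicIrred F)

/-- The residue field at `π`. -/
abbrev Residue : Type := F[X] ⧸ Ideal.span {π.1}

/-- `π` as a unit of the rational function field. -/
noncomputable abbrev unit : (RatFunc F)ˣ := pu π.1 π.2.2.ne_zero

/-- The `π`-adic valuation together with an angular component. -/
noncomputable def tamePair : TamePair (RatFunc F) π.Residue :=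
  (exists_tamePair_irreducible π.2.2).choose

lemma v_self : π.tamePair.v π.unit = .ofAdd 1 :=
  (exists_tamePair_irreducible π.2.2).choose_spec.1

lemma v_pu {p : F[X]} (hp : p ≠ 0) (h : ¬π.1 ∣ p) : π.tamePair.v (pu p hp) = 1 :=
  ((exists_tamePair_irreducible π.2.2).choose_spec.2 p hp h).1

lemma ρ_pu {p : F[X]} (hp : p ≠ 0) (h : ¬π.1 ∣ p) :
    (π.tamePair.ρ (pu p hp) : π.Residue) = Ideal.Quotient.mk _ p :=
  ((exists_tamePair_irreducible π.2.2).choose_spec.2 p hp h).2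

lemma not_dvd {π π' : MonicIrred F} (h : π' ≠ π) : ¬π'.1 ∣ π.1 := fun hd =>
  h (Subtype.ext (eq_of_monic_of_associated π'.2.1 π.2.1
    ((π'.2.2.dvd_irreducible_iff_associated π.2.2).1 hd)))

lemma natDegree_pos : 0 < π.1.natDegree := π.2.2.natDegree_pos

/-- The tame symbol at `π`. -/
noncomputable def tame (n : ℕ) : MilnorK (n + 1) (RatFunc F) →+ MilnorK n π.Residue :=
  π.tamePair.tame (Field.toIsField _) (isField_quotient π.2.2) n

lemma exists_rep (u : π.Residueˣ) : ∃ p : F[X], p ≠ 0 ∧ p.natDegree < π.1.natDegree ∧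
    Ideal.Quotient.mk (Ideal.span {π.1}) p = u := by
  obtain ⟨p, hp⟩ := Ideal.Quotient.mk_surjective (u : π.Residue)
  have hmk : Ideal.Quotient.mk (Ideal.span {π.1}) (p %ₘ π.1) = u := by
    rw [← hp, Ideal.Quotient.eq, Ideal.mem_span_singleton]
    exact ⟨-(p /ₘ π.1), by linear_combination modByMonic_add_div p π.1⟩
  refine ⟨p %ₘ π.1, fun h0 => ?_, natDegree_modByMonic_lt _ π.2.1 π.2.2.ne_one, hmk⟩
  have := (isField_quotient π.2.2).nontrivial
  rw [h0, map_zero] at hmk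
  exact u.ne_zero hmk.symm

/-- The representative of smallest degree of a residue. -/
noncomputable def rep (u : π.Residueˣ) : F[X] := (π.exists_rep u).choose

lemma rep_ne_zero (u : π.Residueˣ) : π.rep u ≠ 0 := (π.exists_rep u).choose_spec.1

lemma natDegree_rep_lt (u : π.Residueˣ) : (π.rep u).natDegree < π.1.natDegree :=
  (π.exists_rep u).choose_spec.2.1

lemma mk_rep (u : π.Residueˣ) : Ideal.Quotient.mk (Ideal.span {π.1}) (π.rep u) = u :=
  (π.exists_rep u).choose_spec.2.2

lemma not_dvd_of_natDegree_lt {p : F[X]} (hp : p ≠ 0) (h : p.natDegree < π.1.natDegree) :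
    ¬π.1 ∣ p := fun hd => hp (eq_zero_of_dvd_of_natDegree_lt hd h)

lemma eq_of_mk_eq {p q : F[X]} (hp : p.natDegree < π.1.natDegree)
    (hq : q.natDegree < π.1.natDegree)
    (h : Ideal.Quotient.mk (Ideal.span {π.1}) p = Ideal.Quotient.mk _ q) : p = q := by
  rw [Ideal.Quotient.eq, Ideal.mem_span_singleton] at h
  exact sub_eq_zero.1 (eq_zero_of_dvd_of_natDegree_lt h
    ((natDegree_sub_le _ _).trans_lt (max_lt hp hq)))

/-- The representative of smallest degree of a residue, as a unit. -/
noncomputable def repUnit (u : π.Residueˣ) : (RatFunc F)ˣ := pu (π.rep u) (π.rep_ne_zero u)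

lemma repUnit_ρ {p : F[X]} (hp : p ≠ 0) (h : p.natDegree < π.1.natDegree) :
    π.repUnit (π.tamePair.ρ (pu p hp)) = pu p hp := by
  have : π.rep (π.tamePair.ρ (pu p hp)) = p := π.eq_of_mk_eq (π.natDegree_rep_lt _) h (by
    rw [mk_rep, ρ_pu _ _ (π.not_dvd_of_natDegree_lt hp h)])
  ext
  simp [repUnit, this]

lemma ρ_repUnit (u : π.Residueˣ) : π.tamePair.ρ (π.repUnit u) = u := by
  ext
  rw [repUnit, ρ_pu _ _ (π.not_dvd_of_natDegree_lt (π.rep_ne_zero u) (π.natDegree_rep_lt u)),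
    mk_rep]

end MonicIrred

/-- The subgroup generated by the nonzero polynomials of degree at most `d`. -/
noncomputable def unitFil (F : Type) [Field F] (d : ℕ) : Subgroup (RatFunc F)ˣ :=
  Subgroup.closure {x | ∃ (p : F[X]) (hp : p ≠ 0), p.natDegree ≤ d ∧ x = pu p hp}

/-- The subgroup generated by symbols of polynomials of degree at most `d`. -/
noncomputable def fil (F : Type) [Field F] (d n : ℕ) : AddSubgroup (MilnorK n (RatFunc F)) :=
  AddSubgroup.closure {x | ∃ f : Fin n → (RatFunc F)ˣ,
    (∀ i, f i ∈ unitFil F d) ∧ x = symbol n (RatFunc F) f}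

lemma pu_mem_unitFil {d : ℕ} {p : F[X]} (hp : p ≠ 0) (h : p.natDegree ≤ d) :
    pu p hp ∈ unitFil F d := Subgroup.subset_closure ⟨p, hp, h, rfl⟩

lemma neg_one_mem_unitFil (d : ℕ) : -1 ∈ unitFil F d := by
  have : (-1 : (RatFunc F)ˣ) = pu (-1 : F[X]) (by simp) := by ext; simp
  rw [this]
  exact pu_mem_unitFil _ (by simp)

lemma symbol_mem_fil {d n : ℕ} {f : Fin n → (RatFunc F)ˣ} (hf : ∀ i, f i ∈ unitFil F d) :
    symbol n (RatFunc F) f ∈ fil F d n := AddSubgroup.subset_closure ⟨f, hf, rfl⟩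

lemma unitFil_mono {d e : ℕ} (h : d ≤ e) : unitFil F d ≤ unitFil F e :=
  Subgroup.closure_mono fun _ ⟨p, hp, hd, hx⟩ => ⟨p, hp, hd.trans h, hx⟩

lemma fil_mono {d e : ℕ} (h : d ≤ e) (n : ℕ) : fil F d n ≤ fil F e n :=
  AddSubgroup.closure_mono fun _ ⟨f, hf, hx⟩ => ⟨f, fun i => unitFil_mono h (hf i), hx⟩

lemma consHom_mem_fil {d n : ℕ} {u : (RatFunc F)ˣ} (hu : u ∈ unitFil F d)
    {x : MilnorK n (RatFunc F)} (hx : x ∈ fil F d n) : consHom u x ∈ fil F d (n + 1) := by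
  have : fil F d n ≤ (fil F d (n + 1)).comap (consHom u) := by
    refine (AddSubgroup.closure_le _).2 ?_
    rintro _ ⟨f, hf, rfl⟩
    change consHom u _ ∈ fil F d (n + 1)
    rw [consHom_symbol]
    exact symbol_mem_fil fun i => by cases i using Fin.cases <;> simp [hu, hf]
  exact this hx

lemma exists_mem_unitFil (f : (RatFunc F)ˣ) : ∃ d, f ∈ unitFil F d := by
  obtain ⟨a, b, ha, hb, rfl⟩ := exists_eq_div f
  exact ⟨max a.natDegree b.natDegree,
    div_mem (pu_mem_unitFil _ (le_max_left _ _)) (pu_mem_unitFil _ (le_max_right _ _))⟩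

lemma exists_mem_fil {n : ℕ} (x : MilnorK n (RatFunc F)) : ∃ d, x ∈ fil F d n := by
  have : x ∈ ⨆ d, fil F d n := by
    refine mem_of_symbol_mem (fun f => ?_) x
    choose d hd using fun i => exists_mem_unitFil (f i)
    exact AddSubgroup.mem_iSup_of_mem (Finset.univ.sup d) (symbol_mem_fil fun i =>
      unitFil_mono (Finset.le_sup (Finset.mem_univ i)) (hd i))
  rwa [AddSubgroup.mem_iSup_of_directed (directed_of_isDirected_le fun _ _ h => fil_mono h n)]
    at this

lemma v_eq_one_of_mem_unitFil (π : MonicIrred F) {d : ℕ} (h : d < π.1.natDegree)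
    {f : (RatFunc F)ˣ} (hf : f ∈ unitFil F d) : π.tamePair.v f = 1 := by
  have : unitFil F d ≤ π.tamePair.v.ker := by
    refine (Subgroup.closure_le _).2 ?_
    rintro _ ⟨p, hp, hd, rfl⟩
    exact π.v_pu hp (π.not_dvd_of_natDegree_lt hp (hd.trans_lt h))
  exact this hf

lemma tame_eq_zero_of_mem_fil (π : MonicIrred F) {d n : ℕ} (h : d < π.1.natDegree)
    {x : MilnorK (n + 1) (RatFunc F)} (hx : x ∈ fil F d (n + 1)) : π.tame n x = 0 := by
  have : fil F d (n + 1) ≤ (π.tame n).ker := by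
    refine (AddSubgroup.closure_le _).2 ?_
    rintro _ ⟨f, hf, rfl⟩
    exact TamePair.tame_symbol_eq_zero _ _ _ _ _ fun i => v_eq_one_of_mem_unitFil π h (hf i)
  exact this hx

lemma tame_consHom_self (π : MonicIrred F) {d n : ℕ} (h : d < π.1.natDegree)
    (f : Fin n → (RatFunc F)ˣ) (hf : ∀ i, f i ∈ unitFil F d) :
    π.tame n (consHom π.unit (symbol n _ f)) = symbol n _ fun i => π.tamePair.ρ (f i) := by
  rw [consHom_symbol]
  exact TamePair.tame_symbol_cons _ _ _ _ _ _ π.v_self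
    fun i => v_eq_one_of_mem_unitFil π h (hf i)

lemma tame_consHom_of_ne {π π' : MonicIrred F} (hne : π' ≠ π) {d n : ℕ} (h : d < π'.1.natDegree)
    (f : Fin n → (RatFunc F)ˣ) (hf : ∀ i, f i ∈ unitFil F d) :
    π'.tame n (consHom π.unit (symbol n _ f)) = 0 := by
  rw [consHom_symbol]
  refine TamePair.tame_symbol_eq_zero _ _ _ _ _ fun i => ?_
  cases i using Fin.cases with
  | zero => exact π'.v_pu π.2.2.ne_zero (MonicIrred.not_dvd hne)
  | succ i => exact v_eq_one_of_mem_unitFil π' h (hf i)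

lemma repUnit_mem {π : MonicIrred F} {d : ℕ} (hd : π.1.natDegree = d + 1) (u : π.Residueˣ) :
    π.repUnit u ∈ unitFil F d :=
  pu_mem_unitFil _ (by have := π.natDegree_rep_lt u; omega)

lemma consHom_div {R : Type} [CommRing R] {n : ℕ} (u v : Rˣ) (x : MilnorK n R) :
    consHom (u / v) x = consHom u x - consHom v x := by
  rw [eq_sub_iff_add_eq, ← consHom_mul, div_mul_cancel]

lemma symbol_update_div {R : Type} [CommRing R] {n : ℕ} (f : Fin n → Rˣ) (i : Fin n) (u v : Rˣ) :
    symbol n R (update f i (u / v)) = symbol n R (update f i u) - symbol n R (update f i v) := by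
  rw [eq_sub_iff_add_eq, ← symbol_update_mul, div_mul_cancel]

lemma update_mem_unitFil {d n : ℕ} {f : Fin n → (RatFunc F)ˣ} (hf : ∀ i, f i ∈ unitFil F d)
    (i : Fin n) {u : (RatFunc F)ˣ} (hu : u ∈ unitFil F d) (j : Fin n) :
    update f i u j ∈ unitFil F d := by
  by_cases h : j = i
  · subst h; simpa using hu
  · rw [update_of_ne h]; exact hf j

lemma consHom_repUnit_mul {π : MonicIrred F} {d : ℕ} (hd : π.1.natDegree = d + 1) {n : ℕ}
    (f : Fin n → (RatFunc F)ˣ) (hf : ∀ i, f i ∈ unitFil F d) (i : Fin n) (u v : π.Residueˣ) :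
    consHom π.unit (symbol n _ (update f i (π.repUnit (u * v)))) -
      (consHom π.unit (symbol n _ (update f i (π.repUnit u))) +
        consHom π.unit (symbol n _ (update f i (π.repUnit v)))) ∈ fil F d (n + 1) := by
  rw [← map_add, ← symbol_update_mul, ← map_sub, ← symbol_update_div]
  have hw : π.repUnit (u * v) / (π.repUnit u * π.repUnit v) ∈ unitFil F d :=
    div_mem (repUnit_mem hd _) (mul_mem (repUnit_mem hd _) (repUnit_mem hd _))
  have hdvd : π.1 ∣ π.rep u * π.rep v - π.rep (u * v) := by
    rw [← Ideal.mem_span_singleton, ← Ideal.Quotient.eq, map_mul, π.mk_rep, π.mk_rep, π.mk_rep,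
      Units.val_mul]
  obtain ⟨e, he⟩ := hdvd
  by_cases he0 : e = 0
  · have : π.repUnit (u * v) / (π.repUnit u * π.repUnit v) = 1 := by
      rw [div_eq_one]
      ext
      rw [he0, mul_zero, sub_eq_zero] at he
      simp [MonicIrred.repUnit, ← he]
    rw [this]
    have h1 : symbol n (RatFunc F) (update f i 1) = 0 := (slotHom f i).map_zero
    rw [h1, map_zero]
    exact zero_mem _
  have hdeg : e.natDegree ≤ d := by
    have h1 := congrArg natDegree he
    rw [natDegree_mul π.2.2.ne_zero he0] at h1
    have h2 := natDegree_sub_le (π.rep u * π.rep v) (π.rep (u * v))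
    rw [natDegree_mul (π.rep_ne_zero u) (π.rep_ne_zero v)] at h2
    have := π.natDegree_rep_lt u
    have := π.natDegree_rep_lt v
    have := π.natDegree_rep_lt (u * v)
    omega
  have key : consHom (π.unit * (pu e he0 / (π.repUnit u * π.repUnit v)))
      (symbol n _ (update f i (π.repUnit (u * v) / (π.repUnit u * π.repUnit v)))) = 0 := by
    rw [consHom_symbol]
    refine symbol_eq_zero _ (i := 0) (j := i.succ) (Fin.succ_ne_zero i).symm ?_
    have hu0 : algebraMap F[X] (RatFunc F) (π.rep u) ≠ 0 := by simpa using π.rep_ne_zero u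
    have hv0 : algebraMap F[X] (RatFunc F) (π.rep v) ≠ 0 := by simpa using π.rep_ne_zero v
    have he' := congrArg (algebraMap F[X] (RatFunc F)) he
    rw [map_sub, map_mul, map_mul] at he'
    simp only [Fin.cons_zero, Fin.cons_succ, update_self, MonicIrred.repUnit, Units.val_mul,
      Units.val_div_eq_div_val, coe_pu]
    field_simp
    linear_combination -he'
  rw [consHom_mul] at key
  rw [eq_neg_of_add_eq_zero_left key]
  refine neg_mem (consHom_mem_fil ?_ (symbol_mem_fil (update_mem_unitFil hf i hw)))
  exact div_mem (pu_mem_unitFil _ hdeg) (mul_mem (repUnit_mem hd _) (repUnit_mem hd _))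

/-- The map `{ū₁, …, ūₙ} ↦ {π, u₁, …, uₙ}` modulo symbols of polynomials of smaller degree. -/
noncomputable def cosymbol {π : MonicIrred F} {d : ℕ} (hd : π.1.natDegree = d + 1) (n : ℕ) :
    MilnorK n π.Residue →+ MilnorK (n + 1) (RatFunc F) ⧸ fil F d (n + 1) :=
  lift (fun u => QuotientAddGroup.mk (consHom π.unit (symbol n _ fun i => π.repUnit (u i))))
    (fun f i u v => by
      rw [← QuotientAddGroup.mk_add, eq_comm, QuotientAddGroup.eq, neg_add_eq_sub]
      have e (w : π.Residueˣ) : (fun j => π.repUnit (update f i w j)) =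
        update (fun j => π.repUnit (f j)) i (π.repUnit w) := comp_update π.repUnit f i w
      rw [e, e, e]
      exact consHom_repUnit_mul hd _ (fun _ => repUnit_mem hd _) i u v)
    (fun f i j hij h => by
      have : π.rep (f i) + π.rep (f j) = 1 := π.eq_of_mk_eq
        ((natDegree_add_le _ _).trans_lt (max_lt (π.natDegree_rep_lt _) (π.natDegree_rep_lt _)))
        (by simpa using π.natDegree_pos)
        (by rw [map_add, π.mk_rep, π.mk_rep, h, map_one])
      rw [symbol_eq_zero _ hij, map_zero, QuotientAddGroup.mk_zero]
      simp [MonicIrred.repUnit, ← map_add, this])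

lemma cosymbol_symbol {π : MonicIrred F} {d : ℕ} (hd : π.1.natDegree = d + 1) (n : ℕ)
    (u : Fin n → π.Residueˣ) : cosymbol hd n (symbol n _ u) =
      QuotientAddGroup.mk (consHom π.unit (symbol n _ fun i => π.repUnit (u i))) :=
  lift_symbol _ _ _ _

end Filtration

section Exactness

variable {F : Type} [Field F]

lemma mem_of_mem_unitFil_succ {d : ℕ} {N : Subgroup (RatFunc F)ˣ} (h : unitFil F d ≤ N)
    (hπ : ∀ π : MonicIrred F, π.1.natDegree = d + 1 → π.unit ∈ N) : unitFil F (d + 1) ≤ N := by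
  refine (Subgroup.closure_le _).2 ?_
  rintro _ ⟨p, hp, hd, rfl⟩
  rcases hd.lt_or_eq with hd | hd
  · exact h (pu_mem_unitFil hp (by omega))
  by_cases hirr : Irreducible p
  · have hC' : C p.leadingCoeff⁻¹ ≠ 0 := by simpa using hp
    have hm : (p * C p.leadingCoeff⁻¹).Monic := monic_mul_leadingCoeff_inv hp
    have hu : IsUnit (C p.leadingCoeff⁻¹) := by simpa using hp
    let π : MonicIrred F := ⟨p * C p.leadingCoeff⁻¹, hm, (irreducible_mul_isUnit hu).2 hirr⟩
    have hπd : π.1.natDegree = d + 1 := by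
      simpa [π, natDegree_mul hp hC'] using hd
    have hmul : π.unit = pu p hp * pu _ hC' := pu_mul hp hC'
    have e : pu p hp = π.unit * (pu _ hC')⁻¹ := eq_mul_inv_iff_mul_eq.2 hmul.symm
    change pu p hp ∈ N
    rw [e]
    exact mul_mem (hπ π hπd) (inv_mem (h (pu_mem_unitFil _ (by simp))))
  · have hnu : ¬IsUnit p := fun hu => by simp [natDegree_eq_zero_of_isUnit hu] at hd
    rw [irreducible_iff, not_and] at hirr
    have := hirr hnu
    push Not at this
    obtain ⟨a, b, rfl, ha, hb⟩ := this
    obtain ⟨ha0, hb0⟩ := mul_ne_zero_iff.1 hp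
    rw [natDegree_mul ha0 hb0] at hd
    have ha' := natDegree_pos_iff_degree_pos.2 (degree_pos_of_ne_zero_of_nonunit ha0 ha)
    have hb' := natDegree_pos_iff_degree_pos.2 (degree_pos_of_ne_zero_of_nonunit hb0 hb)
    change pu (a * b) _ ∈ N
    rw [pu_mul ha0 hb0]
    exact mul_mem (h (pu_mem_unitFil _ (by omega))) (h (pu_mem_unitFil _ (by omega)))

/-- The subgroup generated by `fil F d` and the products `{π} y` with `π` monic irreducible of
degree `d + 1` and `y ∈ fil F d`. -/
noncomputable def stepFil (F : Type) [Field F] (d n : ℕ) :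
    AddSubgroup (MilnorK (n + 1) (RatFunc F)) :=
  fil F d (n + 1) ⊔ AddSubgroup.closure {x | ∃ (π : MonicIrred F) (y : MilnorK n (RatFunc F)),
    π.1.natDegree = d + 1 ∧ y ∈ fil F d n ∧ x = consHom π.unit y}

lemma stepFil_le {d n : ℕ} {N : AddSubgroup (MilnorK (n + 1) (RatFunc F))}
    (h : fil F d (n + 1) ≤ N) (hπ : ∀ (π : MonicIrred F) (y : MilnorK n (RatFunc F)),
      π.1.natDegree = d + 1 → y ∈ fil F d n → consHom π.unit y ∈ N) : stepFil F d n ≤ N :=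
  sup_le h ((AddSubgroup.closure_le _).2 (by rintro _ ⟨π, y, h1, h2, rfl⟩; exact hπ π y h1 h2))

lemma fil_le_stepFil (d n : ℕ) : fil F d (n + 1) ≤ stepFil F d n := le_sup_left

lemma consHom_unit_mem_stepFil {d n : ℕ} {π : MonicIrred F} (hd : π.1.natDegree = d + 1)
    {y : MilnorK n (RatFunc F)} (hy : y ∈ fil F d n) : consHom π.unit y ∈ stepFil F d n :=
  AddSubgroup.mem_sup_right (AddSubgroup.subset_closure ⟨π, y, hd, hy, rfl⟩)

/-- The units `u` such that `{u} x` lies in `N`. -/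
def consStab {n : ℕ} {R : Type} [CommRing R] (N : AddSubgroup (MilnorK (n + 1) R))
    (x : MilnorK n R) : Subgroup Rˣ :=
  (N.comap (AddMonoidHom.mk' (fun u : Additive Rˣ => consHom u.toMul x)
    (fun _ _ => consHom_mul _ _ x))).toSubgroup'

lemma mem_consStab {n : ℕ} {R : Type} [CommRing R] {N : AddSubgroup (MilnorK (n + 1) R)}
    {x : MilnorK n R} {u : Rˣ} : u ∈ consStab N x ↔ consHom u x ∈ N := Iff.rfl

lemma consHom_mem_stepFil {d n : ℕ} {u : (RatFunc F)ˣ} (hu : u ∈ unitFil F (d + 1))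
    {x : MilnorK n (RatFunc F)} (hx : x ∈ fil F d n) : consHom u x ∈ stepFil F d n := by
  have : unitFil F (d + 1) ≤ consStab (stepFil F d n) x :=
    mem_of_mem_unitFil_succ (fun v hv => fil_le_stepFil _ _ (consHom_mem_fil hv hx))
      (fun π hπ => consHom_unit_mem_stepFil hπ hx)
  exact this hu

lemma consHom_unit_consHom_unit {d n : ℕ} {π π' : MonicIrred F} (hd : π.1.natDegree = d + 1)
    (hd' : π'.1.natDegree = d + 1) {y : MilnorK n (RatFunc F)} (hy : y ∈ fil F d n) :
    consHom π'.unit (consHom π.unit y) ∈ stepFil F d (n + 1) := by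
  have hK := Field.toIsField (RatFunc F)
  have hself : consHom π'.unit (consHom π'.unit y) ∈ stepFil F d (n + 1) := by
    rw [consHom_self hK]
    exact consHom_unit_mem_stepFil hd' (consHom_mem_fil (neg_one_mem_unitFil d) hy)
  by_cases hne : π' = π
  · rwa [← hne]
  have hf0 : π'.1 - π.1 ≠ 0 := fun h => hne (Subtype.ext (sub_eq_zero.1 h))
  have hfd : (π'.1 - π.1).natDegree ≤ d := by
    have hlt := degree_sub_lt_left (p := π'.1) (q := π.1)
      (by rw [degree_eq_natDegree π'.2.2.ne_zero, degree_eq_natDegree π.2.2.ne_zero, hd, hd'])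
      π'.2.2.ne_zero (by rw [π'.2.1.leadingCoeff, π.2.1.leadingCoeff])
    have := natDegree_lt_natDegree hf0 hlt
    omega
  have hf := pu_mem_unitFil hf0 hfd
  have h0 : algebraMap F[X] (RatFunc F) π'.1 ≠ 0 := by simpa using π'.2.2.ne_zero
  have key : consHom (pu _ hf0 / π'.unit) (consHom (π.unit / π'.unit) y) = 0 :=
    consHom_steinberg (by simp [field]) y
  rw [consHom_div, consHom_div, map_sub, map_sub, consHom_swap hK (pu _ hf0),
    consHom_swap hK (pu _ hf0)] at key
  have : consHom π'.unit (consHom π.unit y) = consHom π'.unit (consHom π'.unit y) +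
      consHom π'.unit (consHom (pu _ hf0) y) - consHom π.unit (consHom (pu _ hf0) y) := by
    rw [← sub_eq_zero, ← neg_eq_zero, ← key]
    abel
  rw [this]
  exact sub_mem (add_mem hself (consHom_unit_mem_stepFil hd' (consHom_mem_fil hf hy)))
    (consHom_unit_mem_stepFil hd (consHom_mem_fil hf hy))

lemma consHom_mem_stepFil_of_mem {d n : ℕ} {u : (RatFunc F)ˣ} (hu : u ∈ unitFil F (d + 1))
    {x : MilnorK (n + 1) (RatFunc F)} (hx : x ∈ stepFil F d n) :
    consHom u x ∈ stepFil F d (n + 1) := by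
  have : stepFil F d n ≤ (stepFil F d (n + 1)).comap (consHom u) := by
    refine stepFil_le (fun x hx => consHom_mem_stepFil hu hx) fun π y hπ hy => ?_
    have : unitFil F (d + 1) ≤ consStab (stepFil F d (n + 1)) (consHom π.unit y) := by
      refine mem_of_mem_unitFil_succ (fun v hv => ?_)
        (fun π' hπ' => consHom_unit_consHom_unit hπ hπ' hy)
      rw [mem_consStab, consHom_swap (Field.toIsField _)]
      exact neg_mem (consHom_unit_mem_stepFil hπ (consHom_mem_fil hv hy))
    exact this hu
  exact this hx

lemma fil_succ_le_stepFil (d n : ℕ) : fil F (d + 1) (n + 1) ≤ stepFil F d n := by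
  refine (AddSubgroup.closure_le _).2 ?_
  rintro _ ⟨f, hf, rfl⟩
  change symbol _ _ f ∈ stepFil F d n
  induction n with
  | zero =>
    induction f using Fin.consCases with
    | cons a f =>
      rw [← consHom_symbol]
      exact consHom_mem_stepFil (by simpa using hf 0) (symbol_mem_fil fun i => i.elim0)
  | succ n ih =>
    induction f using Fin.consCases with
    | cons a f =>
      rw [← consHom_symbol]
      exact consHom_mem_stepFil_of_mem (by simpa using hf 0)
        (ih f fun i => by simpa using hf i.succ)

/-- The monic irreducible polynomials of degree `d + 1`. -/
abbrev MonicIrredOfDegree (F : Type) [Field F] (d : ℕ) : Type :=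
  {π : MonicIrred F // π.1.natDegree = d + 1}

/-- The elements which are recovered from their tame symbols at the monic irreducible polynomials
of degree `d + 1`, modulo `fil F d`. -/
noncomputable def recovered (F : Type) [Field F] (d n : ℕ) :
    AddSubgroup (MilnorK (n + 1) (RatFunc F)) where
  carrier := {x | ∃ s₀ : Finset (MonicIrredOfDegree F d), ∀ s, s₀ ⊆ s →
    (QuotientAddGroup.mk x : _ ⧸ fil F d (n + 1)) = ∑ π ∈ s, cosymbol π.2 n (π.1.tame n x)}
  zero_mem' := ⟨∅, fun s _ => by simp⟩
  add_mem' := by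
    classical
    rintro x y ⟨s, hs⟩ ⟨t, ht⟩
    refine ⟨s ∪ t, fun r hr => ?_⟩
    rw [QuotientAddGroup.mk_add, hs r (Finset.union_subset_left hr),
      ht r (Finset.union_subset_right hr), ← Finset.sum_add_distrib]
    simp only [map_add]
  neg_mem' := by
    rintro x ⟨s, hs⟩
    refine ⟨s, fun r hr => ?_⟩
    rw [QuotientAddGroup.mk_neg, hs r hr, ← Finset.sum_neg_distrib]
    simp only [map_neg]

lemma stepFil_le_recovered (d n : ℕ) : stepFil F d n ≤ recovered F d n := by
  classical
  refine stepFil_le (fun x hx => ⟨∅, fun s _ => ?_⟩) fun π y hπ hy => ?_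
  · rw [(QuotientAddGroup.eq_zero_iff x).2 hx, Finset.sum_eq_zero]
    intro π _
    rw [tame_eq_zero_of_mem_fil π.1 (by rw [π.2]; omega) hx, map_zero]
  · have : fil F d n ≤ (recovered F d n).comap (consHom π.unit) := by
      refine (AddSubgroup.closure_le _).2 ?_
      rintro _ ⟨f, hf, rfl⟩
      refine symbol_mem_of_mem_closure _ (fun f hf => ?_) f hf
      have hf' (i : Fin n) : f i ∈ unitFil F d := Subgroup.subset_closure (hf i)
      refine ⟨{⟨π, hπ⟩}, fun s hs => ?_⟩
      rw [Finset.sum_eq_single_of_mem ⟨π, hπ⟩ (hs (by simp))]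
      · rw [tame_consHom_self π (by omega) f hf', cosymbol_symbol]
        congr 3
        ext i
        obtain ⟨p, hp, hpd, h⟩ := hf i
        rw [h, π.repUnit_ρ hp (by omega)]
      · rintro ⟨π', hπ'⟩ - hne
        rw [tame_consHom_of_ne (fun h => hne (Subtype.ext h)) (d := d) (by rw [hπ']; omega) f hf',
          map_zero]
    exact this hy

lemma mem_fil_of_tame_eq_zero {d n : ℕ} {x : MilnorK (n + 1) (RatFunc F)}
    (hx : x ∈ fil F (d + 1) (n + 1))
    (h : ∀ π : MonicIrred F, π.1.natDegree = d + 1 → π.tame n x = 0) : x ∈ fil F d (n + 1) := by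
  obtain ⟨s, hs⟩ := stepFil_le_recovered d n (fil_succ_le_stepFil d n hx)
  have := hs s subset_rfl
  rw [Finset.sum_eq_zero (fun π _ => by rw [h π.1 π.2, map_zero])] at this
  exact (QuotientAddGroup.eq_zero_iff x).1 this

/-- The homomorphism of Milnor K-groups induced by a ring homomorphism. -/
def map {R S : Type} [CommRing R] [CommRing S] (φ : R →+* S) (n : ℕ) :
    MilnorK n R →+ MilnorK n S :=
  lift (fun f => symbol n S fun i => Units.map (φ : R →* S) (f i))
    (fun f i u v => by
      have e (w : Rˣ) : (fun j => Units.map (φ : R →* S) (update f i w j)) =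
        update (fun j => Units.map (φ : R →* S) (f j)) i (Units.map (φ : R →* S) w) :=
        comp_update _ f i w
      rw [e, e, e, map_mul, symbol_update_mul])
    (fun f i j hij h => symbol_eq_zero _ hij (by simp [← map_add, h]))

lemma map_symbol {R S : Type} [CommRing R] [CommRing S] (φ : R →+* S) (n : ℕ) (f : Fin n → Rˣ) :
    map φ n (symbol n R f) = symbol n S fun i => Units.map (φ : R →* S) (f i) :=
  lift_symbol _ _ _ _

lemma units_map_algebraMap (u : Fˣ) :
    Units.map (algebraMap F (RatFunc F) : F →* RatFunc F) u = pu (C (u : F)) (by simp) := by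
  ext
  simp [RatFunc.algebraMap_C]

lemma fil_zero_le_range (n : ℕ) : fil F 0 n ≤ (map (algebraMap F (RatFunc F)) n).range := by
  have h : unitFil F 0 ≤ (Units.map (algebraMap F (RatFunc F) : F →* RatFunc F)).range := by
    refine (Subgroup.closure_le _).2 ?_
    rintro _ ⟨p, hp, hd, rfl⟩
    obtain ⟨c, rfl⟩ := natDegree_eq_zero.1 (Nat.le_zero.1 hd)
    have hc : c ≠ 0 := by simpa using hp
    exact ⟨Units.mk0 c hc, units_map_algebraMap _⟩
  refine (AddSubgroup.closure_le _).2 ?_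
  rintro _ ⟨f, hf, rfl⟩
  choose u hu using fun i => h (hf i)
  exact ⟨symbol n F u, by rw [map_symbol]; congr 1; funext i; exact hu i⟩

lemma range_le_fil_zero (n : ℕ) (x : MilnorK n F) :
    map (algebraMap F (RatFunc F)) n x ∈ fil F 0 n := by
  refine mem_of_symbol_mem (N := (fil F 0 n).comap (map (algebraMap F (RatFunc F)) n))
    (fun f => ?_) x
  change map _ _ _ ∈ fil F 0 n
  rw [map_symbol]
  exact symbol_mem_fil fun i => by
    rw [units_map_algebraMap]
    exact pu_mem_unitFil _ (by simp)

lemma tame_eq_zero_iff_mem_range (n : ℕ) (x : MilnorK (n + 1) (RatFunc F)) :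
    (∀ π : MonicIrred F, π.tame n x = 0) ↔
      x ∈ Set.range (map (algebraMap F (RatFunc F)) (n + 1)) := by
  constructor
  · intro h
    obtain ⟨d, hd⟩ := exists_mem_fil x
    induction d with
    | zero => exact fil_zero_le_range _ hd
    | succ d ih => exact ih (mem_fil_of_tame_eq_zero hd fun π _ => h π)
  · rintro ⟨y, rfl⟩ π
    exact tame_eq_zero_of_mem_fil π π.natDegree_pos (range_le_fil_zero _ y)

lemma finite_v_ne_one (f : (RatFunc F)ˣ) : {π : MonicIrred F | π.tamePair.v f ≠ 1}.Finite := by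
  classical
  have key (p : F[X]) (hp : p ≠ 0) : {π : MonicIrred F | π.tamePair.v (pu p hp) ≠ 1}.Finite := by
    refine Set.Finite.subset (Set.Finite.preimage (f := Subtype.val)
      Subtype.val_injective.injOn
      (UniqueFactorizationMonoid.normalizedFactors p).toFinset.finite_toSet)
      fun π hπ => ?_
    have hd : π.1 ∣ p := by
      by_contra h
      exact hπ (MonicIrred.v_pu π hp h)
    rw [Set.mem_preimage, Finset.mem_coe, Multiset.mem_toFinset,
      UniqueFactorizationMonoid.mem_normalizedFactors_iff' hp]
    exact ⟨π.2.2, π.2.1.normalize_eq_self, hd⟩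
  obtain ⟨a, b, ha, hb, rfl⟩ := exists_eq_div f
  refine ((key a ha).union (key b hb)).subset fun π hπ => ?_
  by_contra h
  simp only [Set.mem_union, Set.mem_ofPred_eq, not_or, not_not] at h
  exact hπ (by rw [_root_.map_div, h.1, h.2, div_one])

lemma finite_tame_ne_zero (n : ℕ) (x : MilnorK (n + 1) (RatFunc F)) :
    {π : MonicIrred F | π.tame n x ≠ 0}.Finite := by
  have h : x ∈ AddSubgroup.closure (Set.range (symbol (n + 1) (RatFunc F))) := by
    rw [closure_range_symbol]; trivial
  induction h using AddSubgroup.closure_induction with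
  | mem x hx =>
    obtain ⟨f, rfl⟩ := hx
    refine (Set.finite_iUnion fun i => finite_v_ne_one (f i)).subset fun π hπ => ?_
    by_contra h
    simp only [Set.mem_iUnion, Set.mem_ofPred_eq, not_exists, not_not] at h
    exact hπ (TamePair.tame_symbol_eq_zero _ _ _ _ _ h)
  | zero => simp
  | add x y _ _ hx hy =>
    refine (hx.union hy).subset fun π hπ => ?_
    by_contra h
    simp only [Set.mem_union, Set.mem_ofPred_eq, not_or, not_not] at h
    exact hπ (by rw [map_add, h.1, h.2, add_zero])
  | neg x _ hx => simpa using hx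

lemma exists_tame_eq (π : MonicIrred F) (n : ℕ) (w : MilnorK n π.Residue) :
    ∃ x, π.tame n x = w ∧
      ∀ π' : MonicIrred F, π' ≠ π → π.1.natDegree ≤ π'.1.natDegree → π'.tame n x = 0 := by
  let N : AddSubgroup (MilnorK (n + 1) (RatFunc F)) :=
    ⨅ (π' : MonicIrred F) (_ : π' ≠ π) (_ : π.1.natDegree ≤ π'.1.natDegree), (π'.tame n).ker
  have : w ∈ N.map (π.tame n) := by
    refine mem_of_symbol_mem (fun u => ?_) w
    obtain ⟨d, hd⟩ : ∃ d, π.1.natDegree = d + 1 := Nat.exists_eq_succ_of_ne_zero π.natDegree_pos.ne'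
    refine ⟨consHom π.unit (symbol n _ fun i => π.repUnit (u i)), ?_, ?_⟩
    · simp only [N, SetLike.mem_coe, AddSubgroup.mem_iInf, AddMonoidHom.mem_ker]
      exact fun π' hne hle => tame_consHom_of_ne hne (d := d) (by omega) _
        fun i => repUnit_mem hd _
    · rw [tame_consHom_self π (d := d) (by omega) _ fun i => repUnit_mem hd _]
      simp only [π.ρ_repUnit]
  obtain ⟨x, hx, rfl⟩ := this
  simp only [N, SetLike.mem_coe, AddSubgroup.mem_iInf, AddMonoidHom.mem_ker] at hx
  exact ⟨x, rfl, hx⟩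

lemma exists_forall_tame_eq (n D : ℕ) (v : (π : MonicIrred F) → MilnorK n π.Residue)
    (hfin : {π | v π ≠ 0}.Finite) (hD : ∀ π, v π ≠ 0 → π.1.natDegree ≤ D) :
    ∃ x, ∀ π : MonicIrred F, π.tame n x = v π := by
  classical
  induction D generalizing v with
  | zero =>
    refine ⟨0, fun π => ?_⟩
    rw [map_zero, eq_comm]
    by_contra h
    exact π.natDegree_pos.ne' (Nat.le_zero.1 (hD π h))
  | succ D ih =>
    choose g hg hg' using fun π : MonicIrred F => exists_tame_eq π n (v π)
    let x₀ := ∑ π ∈ hfin.toFinset with π.1.natDegree = D + 1, g π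
    have h0 (π : MonicIrred F) (hπ : D + 1 ≤ π.1.natDegree) : π.tame n x₀ = v π := by
      rw [map_sum]
      by_cases hv : v π = 0
      · rw [hv]
        refine Finset.sum_eq_zero fun π' hπ' => ?_
        rw [Finset.mem_filter, Set.Finite.mem_toFinset] at hπ'
        exact hg' π' π (by rintro rfl; exact hπ'.1 hv) (by omega)
      · have := hD π hv
        rw [Finset.sum_eq_single_of_mem π (by simp [hv]; omega), hg]
        intro π' hπ' hne
        rw [Finset.mem_filter] at hπ'
        exact hg' π' π hne.symm (by omega)
    obtain ⟨y, hy⟩ := ih (fun π => v π - π.tame n x₀) (by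
        refine (hfin.union (finite_tame_ne_zero n x₀)).subset fun π hπ => ?_
        by_contra h
        simp only [Set.mem_union, Set.mem_ofPred_eq, not_or, not_not] at h
        exact hπ (by rw [h.1, h.2, sub_zero])) (fun π hπ => by
        by_contra! h
        exact hπ (by rw [h0 π h, sub_self]))
    exact ⟨y + x₀, fun π => by rw [map_add, hy, sub_add_cancel]⟩

lemma exists_retraction (n : ℕ) : ∃ retr : MilnorK n (RatFunc F) →+ MilnorK n F,
    ∀ y, retr (map (algebraMap F (RatFunc F)) n y) = y := by
  obtain ⟨P, hP⟩ := exists_tamePair_leadingCoeff (F := F)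
  refine ⟨P.spec (Field.toIsField _) (Field.toIsField _) n, fun y => ?_⟩
  refine mem_of_symbol_mem (N := ((P.spec (Field.toIsField _) (Field.toIsField _) n).comp
    (map (algebraMap F (RatFunc F)) n)).eqLocus (AddMonoidHom.id _)) (fun f => ?_) y
  change P.spec (Field.toIsField _) (Field.toIsField _) n
    (map (algebraMap F (RatFunc F)) n (symbol n F f)) = symbol n F f
  rw [map_symbol, TamePair.spec_symbol]
  congr 1
  ext i
  rw [units_map_algebraMap, hP, leadingCoeff_C]

end Exactness

end MilnorK

/-- The Bass–Tate/Milnor split short exact sequence for the rational function field: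
`0 → K^M_{q+1}(F) → K^M_{q+1}(F(x)) → ⊕_π K^M_q(F[x]/(π)) → 0`, where `π` runs over the
monic irreducible polynomials, the first map is induced by the inclusion `F ⊂ F(x)` and
the boundary maps `dd_π` are the tame symbols at the corresponding discrete valuations
(characterized by vanishing on symbols of `π`-units and by
`dd_π {π, u₂, …, u_{q+1}} = {ū₂, …, ū_{q+1}}` on `π`-units `uᵢ`). -/
theorem stmt9 (F : Type) [Field F] (q : ℕ) :
    ∃ (ι : MilnorK (q + 1) F →+ MilnorK (q + 1) (RatFunc F))
      (dd : (π : {π : Polynomial F // π.Monic ∧ Irreducible π}) →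
        (MilnorK (q + 1) (RatFunc F) →+ MilnorK q (Polynomial F ⧸ Ideal.span {π.1}))),
      -- the first map is induced by the field inclusion `F ⊂ F(x)`
      (∀ u : Fin (q + 1) → Fˣ,
        ι (MilnorK.symbol (q + 1) F u)
          = MilnorK.symbol (q + 1) (RatFunc F)
              (fun i => Units.map (algebraMap F (RatFunc F) : F →* RatFunc F) (u i))) ∧
      -- the tame symbol kills symbols of `π`-units ...
      (∀ (π : {π : Polynomial F // π.Monic ∧ Irreducible π})
          (p : Fin (q + 1) → Polynomial F) (_ : ∀ i, ¬ π.1 ∣ p i)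
          (hu : ∀ i, IsUnit (algebraMap (Polynomial F) (RatFunc F) (p i))),
        dd π (MilnorK.symbol (q + 1) (RatFunc F) (fun i => (hu i).unit)) = 0) ∧
      -- ... and sends `{π, u₂, …, u_{q+1}}` to the symbol of the residues
      (∀ (π : {π : Polynomial F // π.Monic ∧ Irreducible π})
          (p : Fin q → Polynomial F) (_ : ∀ i, ¬ π.1 ∣ p i)
          (hu : ∀ i, IsUnit (algebraMap (Polynomial F) (RatFunc F) (p i)))
          (hπ : IsUnit (algebraMap (Polynomial F) (RatFunc F) π.1))
          (hres : ∀ i, IsUnit (Ideal.Quotient.mk (Ideal.span {π.1}) (p i))),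
        dd π (MilnorK.symbol (q + 1) (RatFunc F)
              (Fin.cons hπ.unit (fun i => (hu i).unit)))
          = MilnorK.symbol q (Polynomial F ⧸ Ideal.span {π.1}) (fun i => (hres i).unit)) ∧
      -- exactness: `ι` is injective and its image is the kernel of the boundary maps
      Function.Injective ι ∧
      (∀ x, (∀ π, dd π x = 0) ↔ x ∈ Set.range ι) ∧
      -- the boundary maps land in the direct sum, onto which they are jointly surjective
      (∀ x, {π | dd π x ≠ 0}.Finite) ∧
      (∀ (s : Finset {π : Polynomial F // π.Monic ∧ Irreducible π})
          (v : (π : {π : Polynomial F // π.Monic ∧ Irreducible π}) →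
            MilnorK q (Polynomial F ⧸ Ideal.span {π.1})),
        (∀ π ∉ s, v π = 0) → ∃ x, ∀ π, dd π x = v π) ∧
      -- the sequence is split
      (∃ retr : MilnorK (q + 1) (RatFunc F) →+ MilnorK (q + 1) F,
        ∀ y, retr (ι y) = y) := by
  obtain ⟨retr, hretr⟩ := MilnorK.exists_retraction (F := F) (q + 1)
  have hne (π p : Polynomial F) (h : ¬π ∣ p) : p ≠ 0 := fun h0 => h (h0 ▸ dvd_zero _)
  have hunit (p : Polynomial F) (hp : p ≠ 0)
      (hu : IsUnit (algebraMap (Polynomial F) (RatFunc F) p)) : hu.unit = MilnorK.pu p hp :=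
    Units.ext rfl
  refine ⟨MilnorK.map (algebraMap F (RatFunc F)) (q + 1),
    fun π => MilnorK.MonicIrred.tame π q, fun u => MilnorK.map_symbol _ _ _, ?_, ?_,
    Function.LeftInverse.injective hretr, MilnorK.tame_eq_zero_iff_mem_range q,
    MilnorK.finite_tame_ne_zero q, ?_, retr, hretr⟩
  · intro π p hp hu
    refine MilnorK.TamePair.tame_symbol_eq_zero _ _ _ _ _ fun i => ?_
    rw [hunit _ (hne _ _ (hp i))]
    exact MilnorK.MonicIrred.v_pu π _ (hp i)
  · intro π p hp hu hπ hres
    rw [hunit _ π.2.2.ne_zero]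
    refine (MilnorK.TamePair.tame_symbol_cons _ _ _ _ _ _
      (MilnorK.MonicIrred.v_self π) fun i => ?_).trans ?_
    · rw [hunit _ (hne _ _ (hp i))]
      exact MilnorK.MonicIrred.v_pu π _ (hp i)
    · congr 1
      ext i
      rw [hunit _ (hne _ _ (hp i))]
      exact MilnorK.MonicIrred.ρ_pu π _ (hp i)
  · intro s v hv
    have hs (π) (h : v π ≠ 0) : π ∈ s := by
      by_contra h'
      exact h (hv π h')
    exact MilnorK.exists_forall_tame_eq q (s.sup fun π => π.1.natDegree) v
      (s.finite_toSet.subset hs)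
      fun π h => Finset.le_sup (f := fun π => π.1.natDegree) (hs π h)
end
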